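/- arXiv:2404.09399 — 2 statements merged into one kernel-verified Lean document; each statement's English description precedes it below -/
import Mathlib

section
/- Let d = p² with p prime. Then KD⁺ ∩ span_ℝ(A ∪ B ∪ C) = ConvHull(A ∪ B ∪ C); that is, a density matrix is KD classical and lies in the real span of A ∪ B ∪ C if and only if it lies in the convex hull of A ∪ B ∪ C. -/
open Complex Matrix
open scoped ComplexOrder

noncomputable section

/-- `omega n = exp(2 π i / n)`, a primitive `n`-th root of unity. -/
def omega (n : ℕ) : ℂ := Complex.exp (2 * Real.pi * Complex.I / n)

/-- The standard basis vector `a i` of `ℂ^d`. -/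
def stdVec (d : ℕ) (i : Fin d) : Fin d → ℂ := fun k => if k = i then 1 else 0

/-- The Fourier (DFT) basis vector `b j = (1/√d) ∑ i, ω_d^(i j) • a i`. -/
def fourierVec (d : ℕ) (j : Fin d) : Fin d → ℂ :=
  fun i => ((1 / Real.sqrt d : ℝ) : ℂ) * omega d ^ (i.val * j.val)

/-- The rank-one projector `|v⟩⟨v|` of a vector `v`, as a matrix. -/
def proj (d : ℕ) (v : Fin d → ℂ) : Matrix (Fin d) (Fin d) ℂ :=
  Matrix.of fun i k => v i * (starRingEnd ℂ) (v k)

/-- The Kirkwood-Dirac quasiprobability `Q i j F = ⟨b j|a i⟩ * ⟨a i|F|b j⟩`. -/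
def KDQ (d : ℕ) (F : Matrix (Fin d) (Fin d) ℂ) (i j : Fin d) : ℂ :=
  (starRingEnd ℂ) (fourierVec d j i) * ∑ k, F i k * fourierVec d j k

/-- The set `KD⁺` of KD classical density matrices: positive semidefinite, trace one,
and all KD quasiprobabilities are nonnegative reals. -/
def KDplus (d : ℕ) : Set (Matrix (Fin d) (Fin d) ℂ) :=
  {ρ | ρ.PosSemidef ∧ ρ.trace = 1 ∧
    ∀ i j, (KDQ d ρ i j).im = 0 ∧ 0 ≤ (KDQ d ρ i j).re}

/-- The set `KD^r` of self-adjoint operators whose KD distribution is everywhere real. -/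
def KDr (d : ℕ) : Set (Matrix (Fin d) (Fin d) ℂ) :=
  {F | F.IsHermitian ∧ ∀ i j, (KDQ d F i j).im = 0}

/-- `A = {|a i⟩⟨a i| : i ∈ ℤ_d}`. -/
def setA (d : ℕ) : Set (Matrix (Fin d) (Fin d) ℂ) :=
  {M | ∃ i : Fin d, M = proj d (stdVec d i)}

/-- `B = {|b j⟩⟨b j| : j ∈ ℤ_d}`. -/
def setB (d : ℕ) : Set (Matrix (Fin d) (Fin d) ℂ) :=
  {M | ∃ j : Fin d, M = proj d (fourierVec d j)}

/-- For `d = p * q` : `ψ m s = (1/√q) ∑ k ∈ ℤ_q, ω_q^(s k) • a (k p + m)`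
(so the `i`-th coordinate is nonzero iff `i ≡ m [MOD p]`, with `k = i / p`). -/
def psiPQ (d p q : ℕ) (m : Fin p) (s : Fin q) : Fin d → ℂ :=
  fun i => if i.val % p = m.val then
    ((1 / Real.sqrt q : ℝ) : ℂ) * omega q ^ (s.val * (i.val / p)) else 0

/-- For `d = p * q` : `φ m' s' = (1/√p) ∑ k ∈ ℤ_p, ω_p^(s' k) • a (k q + m')`. -/
def phiPQ (d p q : ℕ) (m' : Fin q) (s' : Fin p) : Fin d → ℂ :=
  fun i => if i.val % q = m'.val then
    ((1 / Real.sqrt p : ℝ) : ℂ) * omega p ^ (s'.val * (i.val / q)) else 0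

/-- For `d = p ^ 2` : `C = {|ψ m s⟩⟨ψ m s| : m, s ∈ ℤ_p}`. -/
def setC2 (d p : ℕ) : Set (Matrix (Fin d) (Fin d) ℂ) :=
  {M | ∃ m s : Fin p, M = proj d (psiPQ d p p m s)}

/-- For `d = p * q` : `C = {|ψ m s⟩⟨ψ m s| : m ∈ ℤ_p, s ∈ ℤ_q}`. -/
def setC (d p q : ℕ) : Set (Matrix (Fin d) (Fin d) ℂ) :=
  {M | ∃ (m : Fin p) (s : Fin q), M = proj d (psiPQ d p q m s)}

/-- For `d = p * q` : `D = {|φ m' s'⟩⟨φ m' s'| : m' ∈ ℤ_q, s' ∈ ℤ_p}`. -/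
def setD (d p q : ℕ) : Set (Matrix (Fin d) (Fin d) ℂ) :=
  {M | ∃ (m' : Fin q) (s' : Fin p), M = proj d (phiPQ d p q m' s')}

/-- Matrix entries in the Fourier basis: `⟨b k|G|b j⟩`. -/
def entryB (d : ℕ) (G : Matrix (Fin d) (Fin d) ℂ) (k j : Fin d) : ℂ :=
  ∑ i, ∑ l, (starRingEnd ℂ) (fourierVec d k i) * G i l * fourierVec d j l


lemma omega_conj (n : ℕ) (k : ℕ) : omega n ^ k * (starRingEnd ℂ) (omega n ^ k) = 1 := by
  have h : ‖omega n‖ = 1 := by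
    have : (2 * Real.pi * Complex.I / n : ℂ) = ((2 * Real.pi / n : ℝ) : ℂ) * Complex.I := by
      push_cast; ring
    rw [omega, this, Complex.norm_exp_ofReal_mul_I]
  rw [Complex.mul_conj, Complex.normSq_eq_norm_sq, norm_pow, h]; simp

lemma omega_prim (n : ℕ) (hn : n ≠ 0) : IsPrimitiveRoot (omega n) n :=
  Complex.isPrimitiveRoot_exp n hn

lemma omega_sq (p : ℕ) (hp : p ≠ 0) : omega (p * p) ^ p = omega p := by
  have : (p : ℂ) ≠ 0 := by exact_mod_cast hp
  rw [omega, omega, ← Complex.exp_nat_mul]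
  congr 1
  push_cast
  field_simp

lemma omega_sum (p : ℕ) (hp : p ≠ 0) (a b : ℕ) :
    ∑ t : Fin p, omega p ^ (a * t.val) * (starRingEnd ℂ) (omega p ^ (b * t.val))
      = if a ≡ b [MOD p] then (p : ℂ) else 0 := by
  set z : ℂ := omega p ^ a * (starRingEnd ℂ) (omega p ^ b) with hz
  have h1 : ∀ t : Fin p, omega p ^ (a * t.val) * (starRingEnd ℂ) (omega p ^ (b * t.val))
      = z ^ t.val := by
    intro t
    rw [hz, pow_mul, pow_mul, map_pow _ (omega p ^ b), mul_pow]
  rw [Finset.sum_congr rfl (fun t _ => h1 t), Fin.sum_univ_eq_sum_range (fun t => z ^ t) p]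
  have hzp : z ^ p = 1 := by
    rw [hz, mul_pow, ← map_pow, ← pow_mul, ← pow_mul, mul_comm a, mul_comm b, pow_mul, pow_mul,
      (omega_prim p hp).pow_eq_one]
    simp
  have hiff : z = 1 ↔ a ≡ b [MOD p] := by
    have hb := omega_conj p b
    have h2 : z = 1 ↔ omega p ^ a = omega p ^ b := by
      constructor
      · intro h
        calc omega p ^ a = omega p ^ a * (omega p ^ b * (starRingEnd ℂ) (omega p ^ b)) := by
              rw [hb, mul_one]
          _ = omega p ^ b * z := by rw [hz]; ring
          _ = _ := by rw [h, mul_one]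
      · intro h
        rw [hz, h, hb]
    have hfin : IsOfFinOrder (omega p) :=
      isOfFinOrder_iff_pow_eq_one.2 ⟨p, Nat.pos_of_ne_zero hp, (omega_prim p hp).pow_eq_one⟩
    have h3 := hfin.pow_eq_pow_iff_modEq (n := a) (m := b)
    rw [← (omega_prim p hp).eq_orderOf] at h3
    rw [h2, h3]
  split_ifs with h
  · rw [hiff.2 h]; simp
  · have hne : z - 1 ≠ 0 := sub_ne_zero.2 (fun h' => h (hiff.1 h'))
    have := geom_sum_mul z p
    rw [hzp, sub_self] at this
    exact (mul_eq_zero.1 this).resolve_right hne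

lemma sqrt_mul_aux (p : ℕ) :
    ((1 / Real.sqrt p : ℝ) : ℂ) * (starRingEnd ℂ) ((1 / Real.sqrt p : ℝ) : ℂ) = 1 / p := by
  rw [Complex.conj_ofReal, ← Complex.ofReal_mul]
  have : 1 / Real.sqrt p * (1 / Real.sqrt p) = 1 / (p : ℝ) := by
    rw [div_mul_div_comm, Real.mul_self_sqrt (Nat.cast_nonneg p), one_mul]
  rw [this]; simp

lemma idx_val (p : ℕ) (t m : Fin p) : (finProdFinEquiv (t, m)).val = m.val + p * t.val := by
  simp [finProdFinEquiv]

lemma idx_mod (p : ℕ) (t m : Fin p) : (finProdFinEquiv (t, m)).val % p = m.val := by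
  rw [idx_val, Nat.add_mul_mod_self_left, Nat.mod_eq_of_lt m.isLt]

lemma idx_div (p : ℕ) (t m : Fin p) : (finProdFinEquiv (t, m)).val / p = t.val := by
  have hp : 0 < p := m.pos
  rw [idx_val, Nat.add_mul_div_left _ _ hp, Nat.div_eq_of_lt m.isLt, zero_add]

lemma omega_dd (p : ℕ) (hp : p ≠ 0) (m n : ℕ) : omega (p * p) ^ (p * m * n) = omega p ^ (m * n) := by
  rw [mul_assoc, pow_mul, omega_sq p hp]

/-- entries of `C`. -/
lemma projC_apply (p : ℕ) (m s t m1 u m2 : Fin p) :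
    proj (p * p) (psiPQ (p * p) p p m s) (finProdFinEquiv (t, m1)) (finProdFinEquiv (u, m2))
      = if m1 = m ∧ m2 = m then
        1 / p * (omega p ^ (t.val * s.val) * (starRingEnd ℂ) (omega p ^ (u.val * s.val))) else 0 := by
  simp only [proj, psiPQ, Matrix.of_apply, idx_mod, idx_div, Fin.val_inj]
  by_cases h1 : m1 = m <;> by_cases h2 : m2 = m <;> simp only [h1, h2, if_true, if_false, and_true,
    and_false, and_self, map_zero, mul_zero, zero_mul]
  rw [map_mul, mul_mul_mul_comm, sqrt_mul_aux, mul_comm s.val, mul_comm s.val]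

lemma modEq_fin (p : ℕ) (t u : Fin p) : t.val ≡ u.val [MOD p] ↔ t = u := by
  rw [Nat.ModEq, Nat.mod_eq_of_lt t.isLt, Nat.mod_eq_of_lt u.isLt, Fin.val_inj]

lemma sumA (p : ℕ) (hp : p ≠ 0) (m : Fin p) :
    ∑ t : Fin p, proj (p * p) (stdVec (p * p) (finProdFinEquiv (t, m)))
      = ∑ s : Fin p, proj (p * p) (psiPQ (p * p) p p m s) := by
  have hpc : (p : ℂ) ≠ 0 := by exact_mod_cast hp
  ext i k
  obtain ⟨⟨t1, m1⟩, rfl⟩ := finProdFinEquiv.surjective i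
  obtain ⟨⟨t2, m2⟩, rfl⟩ := finProdFinEquiv.surjective k
  rw [Matrix.sum_apply, Matrix.sum_apply]
  simp only [projC_apply]
  by_cases h : m1 = m ∧ m2 = m
  · simp only [h, and_self, if_true]
    rw [← Finset.mul_sum, omega_sum p hp]
    simp only [modEq_fin, proj, stdVec, Matrix.of_apply, EmbeddingLike.apply_eq_iff_eq,
      Prod.mk.injEq, h.1, h.2, and_true]
    by_cases h12 : t1 = t2
    · simp [h12, hpc]
    · rw [if_neg h12, mul_zero]
      apply Finset.sum_eq_zero
      intro x _
      by_cases h' : t1 = x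
      · subst h'; simp [Ne.symm h12]
      · simp [h']
  · simp only [h, if_false, Finset.sum_const_zero]
    apply Finset.sum_eq_zero
    intro x _
    simp only [proj, stdVec, Matrix.of_apply, EmbeddingLike.apply_eq_iff_eq, Prod.mk.injEq]
    by_cases h1 : m1 = m
    · have h2 : m2 ≠ m := fun h2 => h ⟨h1, h2⟩
      simp [h2]
    · simp [h1]

/-- phases factor. -/
lemma omega_idx (p : ℕ) (hp : p ≠ 0) (t m u s : Fin p) :
    omega (p * p) ^ ((finProdFinEquiv (t, m)).val * (finProdFinEquiv (u, s)).val)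
      = omega (p * p) ^ (m.val * s.val) * omega p ^ (m.val * u.val) * omega p ^ (t.val * s.val) := by
  rw [idx_val, idx_val]
  have : (m.val + p * t.val) * (s.val + p * u.val)
      = m.val * s.val + p * m.val * u.val + p * t.val * s.val + (p * p) * (t.val * u.val) := by ring
  rw [this, pow_add, pow_add, pow_add, omega_dd p hp, omega_dd p hp, pow_mul _ (p * p),
    (omega_prim (p * p) (mul_ne_zero hp hp)).pow_eq_one]
  simp

lemma projB_apply (p : ℕ) (u s : Fin p) (i k : Fin (p * p)) :
    proj (p * p) (fourierVec (p * p) (finProdFinEquiv (u, s))) i k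
      = 1 / ((p * p : ℕ) : ℂ) * (omega (p * p) ^ (i.val * (finProdFinEquiv (u, s)).val) *
          (starRingEnd ℂ) (omega (p * p) ^ (k.val * (finProdFinEquiv (u, s)).val))) := by
  simp only [proj, fourierVec, Matrix.of_apply]
  rw [map_mul, mul_mul_mul_comm, sqrt_mul_aux]

lemma sumB (p : ℕ) (hp : p ≠ 0) (s : Fin p) :
    ∑ u : Fin p, proj (p * p) (fourierVec (p * p) (finProdFinEquiv (u, s)))
      = ∑ m : Fin p, proj (p * p) (psiPQ (p * p) p p m s) := by
  have hpc : (p : ℂ) ≠ 0 := by exact_mod_cast hp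
  ext i k
  obtain ⟨⟨t1, m1⟩, rfl⟩ := finProdFinEquiv.surjective i
  obtain ⟨⟨t2, m2⟩, rfl⟩ := finProdFinEquiv.surjective k
  rw [Matrix.sum_apply, Matrix.sum_apply]
  simp only [projC_apply, projB_apply, omega_idx p hp]
  have h1 : ∀ u : Fin p, 1 / ((p * p : ℕ) : ℂ) *
      (omega (p * p) ^ (m1.val * s.val) * omega p ^ (m1.val * u.val) * omega p ^ (t1.val * s.val) *
        (starRingEnd ℂ) (omega (p * p) ^ (m2.val * s.val) * omega p ^ (m2.val * u.val) *
          omega p ^ (t2.val * s.val)))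
      = (1 / ((p * p : ℕ) : ℂ) * (omega (p * p) ^ (m1.val * s.val) *
          (starRingEnd ℂ) (omega (p * p) ^ (m2.val * s.val))) *
          (omega p ^ (t1.val * s.val) * (starRingEnd ℂ) (omega p ^ (t2.val * s.val)))) *
        (omega p ^ (m1.val * u.val) * (starRingEnd ℂ) (omega p ^ (m2.val * u.val))) := by
    intro u
    rw [map_mul, map_mul]; ring
  rw [Finset.sum_congr rfl (fun u _ => h1 u), ← Finset.mul_sum, omega_sum p hp]
  simp only [modEq_fin]
  by_cases h : m1 = m2
  · subst h
    simp only [and_self, if_true, omega_conj]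
    rw [Finset.sum_ite_eq]
    simp only [Finset.mem_univ, if_true]
    push_cast
    field_simp
  · rw [if_neg h, mul_zero]
    symm
    apply Finset.sum_eq_zero
    intro x _
    rw [if_neg]
    rintro ⟨rfl, h'⟩
    exact h h'.symm

lemma KDQ_add (d : ℕ) (F G : Matrix (Fin d) (Fin d) ℂ) (i j : Fin d) :
    KDQ d (F + G) i j = KDQ d F i j + KDQ d G i j := by
  simp [KDQ, add_mul, Finset.sum_add_distrib, mul_add]

lemma KDQ_smul (d : ℕ) (r : ℝ) (F : Matrix (Fin d) (Fin d) ℂ) (i j : Fin d) :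
    KDQ d (r • F) i j = r * KDQ d F i j := by
  simp only [KDQ, Matrix.smul_apply, Complex.real_smul, mul_assoc, ← Finset.mul_sum]
  ring

lemma KDQ_sum (d : ℕ) {ι : Type*} (S : Finset ι) (r : ι → ℝ) (F : ι → Matrix (Fin d) (Fin d) ℂ)
    (i j : Fin d) :
    KDQ d (∑ x ∈ S, r x • F x) i j = ∑ x ∈ S, (r x : ℂ) * KDQ d (F x) i j := by
  classical
  induction S using Finset.induction_on with
  | empty => simp [KDQ]
  | insert a S ha ih => rw [Finset.sum_insert ha, Finset.sum_insert ha, KDQ_add, KDQ_smul, ih]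

lemma fourier_self (d : ℕ) (i j : Fin d) :
    (starRingEnd ℂ) (fourierVec d j i) * fourierVec d j i = 1 / (d : ℂ) := by
  rw [mul_comm]
  simp only [fourierVec]
  rw [map_mul, mul_mul_mul_comm, sqrt_mul_aux, omega_conj, mul_one]

lemma KDQ_A (d : ℕ) (i' i j : Fin d) :
    KDQ d (proj d (stdVec d i')) i j = if i = i' then 1 / (d : ℂ) else 0 := by
  simp only [KDQ, proj, stdVec, Matrix.of_apply]
  by_cases h : i = i'
  · subst h
    simp only [if_true, one_mul, apply_ite (starRingEnd ℂ), map_one, map_zero, ite_mul, zero_mul]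
    rw [Finset.sum_ite_eq']
    simp only [Finset.mem_univ, if_true, fourier_self]
  · simp [h]

/-- orthonormality of the Fourier basis -/
lemma fourier_orth (p : ℕ) (hp : p ≠ 0) (j j' : Fin (p * p)) :
    ∑ k, (starRingEnd ℂ) (fourierVec (p * p) j' k) * fourierVec (p * p) j k
      = if j = j' then 1 else 0 := by
  have hd : p * p ≠ 0 := mul_ne_zero hp hp
  have h1 : ∀ k, (starRingEnd ℂ) (fourierVec (p * p) j' k) * fourierVec (p * p) j k
      = 1 / ((p * p : ℕ) : ℂ) * (omega (p * p) ^ (j.val * k.val) *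
        (starRingEnd ℂ) (omega (p * p) ^ (j'.val * k.val))) := by
    intro k
    simp only [fourierVec]
    rw [mul_comm, map_mul, mul_mul_mul_comm, sqrt_mul_aux, mul_comm k.val, mul_comm k.val]
  rw [Finset.sum_congr rfl (fun k _ => h1 k), ← Finset.mul_sum, omega_sum _ hd]
  simp only [modEq_fin]
  split_ifs
  · have : ((p * p : ℕ) : ℂ) ≠ 0 := by exact_mod_cast hd
    field_simp
  · simp

lemma KDQ_B (p : ℕ) (hp : p ≠ 0) (j' i j : Fin (p * p)) :
    KDQ (p * p) (proj (p * p) (fourierVec (p * p) j')) i j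
      = if j = j' then 1 / ((p * p : ℕ) : ℂ) else 0 := by
  simp only [KDQ, proj, Matrix.of_apply, mul_assoc, ← Finset.mul_sum]
  rw [fourier_orth p hp]
  split_ifs with h
  · subst h; rw [mul_one, fourier_self]
  · simp

lemma KDQ_C (p : ℕ) (hp : p ≠ 0) (m s t m1 u s1 : Fin p) :
    KDQ (p * p) (proj (p * p) (psiPQ (p * p) p p m s)) (finProdFinEquiv (t, m1))
      (finProdFinEquiv (u, s1)) = if m1 = m ∧ s1 = s then 1 / ((p * p : ℕ) : ℂ) else 0 := by
  have hpc : (p : ℂ) ≠ 0 := by exact_mod_cast hp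
  rw [KDQ, ← finProdFinEquiv.sum_comp, Fintype.sum_prod_type]
  simp only [projC_apply]
  by_cases h1 : m1 = m
  · subst h1
    simp only [true_and, ite_mul, zero_mul, Finset.sum_ite_eq', Finset.mem_univ, if_true]
    simp only [fourierVec, omega_idx p hp]
    have h2 : ∀ x : Fin p, 1 / (p : ℂ) * (omega p ^ (t.val * s.val) *
        (starRingEnd ℂ) (omega p ^ (x.val * s.val))) *
        (((1 / Real.sqrt (p * p : ℕ) : ℝ) : ℂ) * (omega (p * p) ^ (m1.val * s1.val) *
          omega p ^ (m1.val * u.val) * omega p ^ (x.val * s1.val)))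
        = (1 / (p : ℂ) * omega p ^ (t.val * s.val) * (((1 / Real.sqrt (p * p : ℕ) : ℝ) : ℂ) *
          (omega (p * p) ^ (m1.val * s1.val) * omega p ^ (m1.val * u.val)))) *
          (omega p ^ (s1.val * x.val) * (starRingEnd ℂ) (omega p ^ (s.val * x.val))) := by
      intro x
      rw [mul_comm x.val, mul_comm x.val]; ring
    rw [Finset.sum_congr rfl (fun x _ => h2 x), ← Finset.mul_sum, omega_sum p hp]
    simp only [modEq_fin]
    split_ifs with h
    · subst h
      have e1 := omega_conj (p * p) (m1.val * s1.val)
      have e2 := omega_conj p (m1.val * u.val)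
      have e3 := omega_conj p (t.val * s1.val)
      have e4 := sqrt_mul_aux (p * p)
      simp only [map_mul]
      generalize (starRingEnd ℂ) (omega (p * p) ^ (m1.val * s1.val)) = a1 at *
      generalize (starRingEnd ℂ) (omega p ^ (m1.val * u.val)) = a2 at *
      generalize (starRingEnd ℂ) (omega p ^ (t.val * s1.val)) = a3 at *
      generalize (starRingEnd ℂ) ((1 / Real.sqrt (p * p : ℕ) : ℝ) : ℂ) = a4 at *
      generalize (omega (p * p) ^ (m1.val * s1.val)) = b1 at *
      generalize (omega p ^ (m1.val * u.val)) = b2 at *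
      generalize (omega p ^ (t.val * s1.val)) = b3 at *
      generalize ((1 / Real.sqrt (p * p : ℕ) : ℝ) : ℂ) = b4 at *
      have : a4 * (a1 * a2 * a3) * (1 / (p : ℂ) * b3 * (b4 * (b1 * b2)) * p)
          = (b4 * a4) * (b1 * a1) * (b2 * a2) * (b3 * a3) * (1 / (p : ℂ) * p) := by ring
      rw [this, e1, e2, e3, e4, one_div_mul_cancel hpc]; ring
    · simp
  · simp [h1]

lemma trace_proj (d : ℕ) (v : Fin d → ℂ) : (proj d v).trace = ∑ i, v i * (starRingEnd ℂ) (v i) := by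
  simp [Matrix.trace, proj]

lemma trace_A (d : ℕ) (i : Fin d) : (proj d (stdVec d i)).trace = 1 := by
  rw [trace_proj]; simp [stdVec]

lemma trace_B (p : ℕ) (hp : p ≠ 0) (j : Fin (p * p)) :
    (proj (p * p) (fourierVec (p * p) j)).trace = 1 := by
  rw [trace_proj]
  have := fourier_orth p hp j j
  rw [if_pos rfl] at this
  rw [← this]
  exact Finset.sum_congr rfl (fun _ _ => mul_comm _ _)

lemma trace_C (p : ℕ) (hp : p ≠ 0) (m s : Fin p) :
    (proj (p * p) (psiPQ (p * p) p p m s)).trace = 1 := by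
  have hpc : (p : ℂ) ≠ 0 := by exact_mod_cast hp
  rw [Matrix.trace, ← finProdFinEquiv.sum_comp, Fintype.sum_prod_type]
  simp only [Matrix.diag_apply, projC_apply, and_self, omega_conj]
  simp [hpc]

lemma psd_proj (d : ℕ) (v : Fin d → ℂ) : (proj d v).PosSemidef :=
  Matrix.posSemidef_vecMulVec_self_star v

lemma KDplus_convex (d : ℕ) : Convex ℝ (KDplus d) := by
  rintro F ⟨h1, h2, h3⟩ G ⟨g1, g2, g3⟩ a b ha hb hab
  refine ⟨?_, ?_, ?_⟩
  · exact (h1.smul ha).add (g1.smul hb)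
  · rw [Matrix.trace_add, Matrix.trace_smul, Matrix.trace_smul, h2, g2, ← add_smul, hab, one_smul]
  · intro i j
    rw [KDQ_add, KDQ_smul, KDQ_smul]
    simp only [Complex.add_im, Complex.add_re, Complex.im_ofReal_mul, Complex.re_ofReal_mul,
      (h3 i j).1, (g3 i j).1]
    exact ⟨by simp, add_nonneg (mul_nonneg ha (h3 i j).2) (mul_nonneg hb (g3 i j).2)⟩

lemma one_div_cast (n : ℕ) : ((1 / n : ℂ)).im = 0 ∧ 0 ≤ ((1 / n : ℂ)).re := by
  have : (1 / n : ℂ) = ((1 / n : ℝ) : ℂ) := by simp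
  rw [this, Complex.ofReal_im, Complex.ofReal_re]
  exact ⟨rfl, by positivity⟩

lemma gen_sub (p : ℕ) (hp : p ≠ 0) :
    setA (p * p) ∪ setB (p * p) ∪ setC2 (p * p) p ⊆ KDplus (p * p) := by
  rintro M ((⟨i, rfl⟩ | ⟨j, rfl⟩) | ⟨m, s, rfl⟩)
  · refine ⟨psd_proj _ _, trace_A _ _, fun i' j => ?_⟩
    rw [KDQ_A]
    split_ifs
    · exact one_div_cast _
    · simp
  · refine ⟨psd_proj _ _, trace_B _ hp _, fun i j => ?_⟩
    rw [KDQ_B p hp]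
    split_ifs
    · exact one_div_cast _
    · simp
  · refine ⟨psd_proj _ _, trace_C _ hp _ _, fun i j => ?_⟩
    obtain ⟨⟨t1, m1⟩, rfl⟩ := finProdFinEquiv.surjective i
    obtain ⟨⟨t2, m2⟩, rfl⟩ := finProdFinEquiv.surjective j
    rw [KDQ_C p hp]
    split_ifs
    · exact one_div_cast _
    · simp

/-- The generators, indexed by a sum type. -/
def gen (p : ℕ) : (Fin p × Fin p) ⊕ ((Fin p × Fin p) ⊕ (Fin p × Fin p)) →
    Matrix (Fin (p * p)) (Fin (p * p)) ℂ
  | Sum.inl x => proj (p * p) (stdVec (p * p) (finProdFinEquiv x))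
  | Sum.inr (Sum.inl x) => proj (p * p) (fourierVec (p * p) (finProdFinEquiv x))
  | Sum.inr (Sum.inr x) => proj (p * p) (psiPQ (p * p) p p x.1 x.2)

lemma range_gen (p : ℕ) :
    setA (p * p) ∪ setB (p * p) ∪ setC2 (p * p) p = Set.range (gen p) := by
  ext M
  constructor
  · rintro ((⟨i, rfl⟩ | ⟨j, rfl⟩) | ⟨m, s, rfl⟩)
    · exact ⟨Sum.inl (finProdFinEquiv.symm i), by rw [gen, Equiv.apply_symm_apply]⟩
    · exact ⟨Sum.inr (Sum.inl (finProdFinEquiv.symm j)), by rw [gen, Equiv.apply_symm_apply]⟩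
    · exact ⟨Sum.inr (Sum.inr (m, s)), rfl⟩
  · rintro ⟨x | x | x, rfl⟩
    · exact Or.inl (Or.inl ⟨_, rfl⟩)
    · exact Or.inl (Or.inr ⟨_, rfl⟩)
    · exact Or.inr ⟨_, _, rfl⟩

lemma trace_gen (p : ℕ) (hp : p ≠ 0) (x) : (gen p x).trace = 1 := by
  rcases x with x | x | x
  · exact trace_A _ _
  · exact trace_B _ hp _
  · exact trace_C _ hp _ _

lemma KDQ_comb (p : ℕ) (hp : p ≠ 0) (c : (Fin p × Fin p) ⊕ ((Fin p × Fin p) ⊕ (Fin p × Fin p)) → ℝ)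
    (t m u s : Fin p) :
    KDQ (p * p) (∑ x, c x • gen p x) (finProdFinEquiv (t, m)) (finProdFinEquiv (u, s))
      = (((c (Sum.inl (t, m)) + c (Sum.inr (Sum.inl (u, s))) + c (Sum.inr (Sum.inr (m, s)))) *
        (1 / ((p * p : ℕ) : ℝ)) : ℝ) : ℂ) := by
  rw [KDQ_sum, Fintype.sum_sum_type, Fintype.sum_sum_type]
  simp only [gen, KDQ_A, KDQ_B p hp, KDQ_C p hp, EmbeddingLike.apply_eq_iff_eq]
  have h : ∀ x : Fin p × Fin p, (m = x.1 ∧ s = x.2) ↔ (m, s) = x := by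
    rintro ⟨a, b⟩; simp
  simp only [h, mul_ite, mul_zero, Finset.sum_ite_eq, Finset.mem_univ, if_true]
  push_cast
  ring

lemma comb_eq (p : ℕ) (hp : p ≠ 0) (c : (Fin p × Fin p) ⊕ ((Fin p × Fin p) ⊕ (Fin p × Fin p)) → ℝ)
    (f g : Fin p → ℝ) :
    ∑ x, c x • gen p x =
      ∑ x, (Sum.elim (fun y => c (Sum.inl y) - f y.2)
        (Sum.elim (fun y => c (Sum.inr (Sum.inl y)) - g y.2)
          (fun y => c (Sum.inr (Sum.inr y)) + f y.1 + g y.2)) x : ℝ) • gen p x := by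
  simp only [Fintype.sum_sum_type, Sum.elim_inl, Sum.elim_inr, sub_smul, add_smul,
    Finset.sum_sub_distrib, Finset.sum_add_distrib]
  have hA : ∑ x : Fin p × Fin p, f x.2 • gen p (Sum.inl x)
      = ∑ x : Fin p × Fin p, f x.1 • gen p (Sum.inr (Sum.inr x)) := by
    rw [Fintype.sum_prod_type_right, Fintype.sum_prod_type]
    refine Finset.sum_congr rfl (fun m _ => ?_)
    simp only [gen]
    rw [← Finset.smul_sum, ← Finset.smul_sum, sumA p hp]
  have hB : ∑ x : Fin p × Fin p, g x.2 • gen p (Sum.inr (Sum.inl x))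
      = ∑ x : Fin p × Fin p, g x.2 • gen p (Sum.inr (Sum.inr x)) := by
    rw [Fintype.sum_prod_type_right, Fintype.sum_prod_type_right]
    refine Finset.sum_congr rfl (fun m _ => ?_)
    simp only [gen]
    rw [← Finset.smul_sum, ← Finset.smul_sum, sumB p hp]
  rw [hA, hB]
  abel

/-- For `d = p²` with `p` prime,
`KD⁺ ∩ span_ℝ(A ∪ B ∪ C) = ConvHull(A ∪ B ∪ C)`. -/
theorem stmt2 (p d : ℕ) (hp : p.Prime) (hd : d = p ^ 2) :
    KDplus d ∩ (Submodule.span ℝ (setA d ∪ setB d ∪ setC2 d p) :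
        Set (Matrix (Fin d) (Fin d) ℂ)) =
      convexHull ℝ (setA d ∪ setB d ∪ setC2 d p) := by
  rw [pow_two] at hd
  subst hd
  have hp0 : p ≠ 0 := hp.ne_zero
  apply Set.Subset.antisymm
  · rintro F ⟨⟨-, htr, hQ⟩, hF⟩
    rw [range_gen] at hF ⊢
    obtain ⟨c, rfl⟩ := (Submodule.mem_span_range_iff_exists_fun ℝ).1 hF
    haveI : Nonempty (Fin p) := ⟨⟨0, hp.pos⟩⟩
    have hmin1 : ∀ m : Fin p, ∃ t0 : Fin p, ∀ t, c (Sum.inl (t0, m)) ≤ c (Sum.inl (t, m)) :=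
      fun m => Finite.exists_min (fun t => c (Sum.inl (t, m)))
    have hmin2 : ∀ s : Fin p, ∃ u0 : Fin p, ∀ u,
        c (Sum.inr (Sum.inl (u0, s))) ≤ c (Sum.inr (Sum.inl (u, s))) :=
      fun s => Finite.exists_min (fun u => c (Sum.inr (Sum.inl (u, s))))
    choose t0 ht0 using hmin1
    choose u0 hu0 using hmin2
    have hpos : ∀ m s, 0 ≤ c (Sum.inl (t0 m, m)) + c (Sum.inr (Sum.inl (u0 s, s))) +
        c (Sum.inr (Sum.inr (m, s))) := by
      intro m s
      have h := (hQ (finProdFinEquiv (t0 m, m)) (finProdFinEquiv (u0 s, s))).2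
      rw [KDQ_comb p hp0, Complex.ofReal_re] at h
      have hpp : (0 : ℝ) < 1 / ((p * p : ℕ) : ℝ) := by
        have : 0 < p * p := Nat.mul_pos hp.pos hp.pos
        positivity
      exact nonneg_of_mul_nonneg_left h hpp
    rw [comb_eq p hp0 c (fun m => c (Sum.inl (t0 m, m)))
      (fun s => c (Sum.inr (Sum.inl (u0 s, s))))] at htr ⊢
    refine (convex_convexHull ℝ _).sum_mem ?_ ?_ (fun x _ => subset_convexHull ℝ _ ⟨x, rfl⟩)
    · rintro (⟨t, m⟩ | ⟨u, s⟩ | ⟨m, s⟩) _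
      · simpa using ht0 m t
      · simpa using hu0 s u
      · have := hpos m s
        simp only [Sum.elim_inr]
        linarith
    · rw [Matrix.trace_sum] at htr
      simp only [Matrix.trace_smul, trace_gen p hp0, Complex.real_smul, mul_one] at htr
      exact_mod_cast htr
  · exact Set.subset_inter (convexHull_min (gen_sub p hp0) (KDplus_convex _))
      (convexHull_min Submodule.subset_span (Submodule.convex _))
end
end

section
/- Let d = pq with p, q distinct primes. The real vector space KD^r of self-adjoint operators on ℂ^d whose KD distribution is everywhere real has dimension (2p−1)(2q−1). -/
open Complex Matrix
open scoped ComplexOrder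

noncomputable section

lemma omega_pow_eq (n : ℕ) (k j : ZMod (n+1)) :
    omega (n+1) ^ (k.val * j.val) = ZMod.stdAddChar (k * j) := by
  have h : k * j = (((k.val * j.val : ℕ) : ℤ) : ZMod (n+1)) := by
    push_cast
    simp [ZMod.natCast_zmod_val]
  rw [h, ZMod.stdAddChar_coe, omega, ← Complex.exp_nat_mul]
  congr 1
  push_cast
  ring

lemma KDQ_eq (n : ℕ) (F : Matrix (ZMod (n+1)) (ZMod (n+1)) ℂ) (i j : ZMod (n+1)) :
    KDQ (n+1) F i j = ((1 / ((n:ℝ)+1) : ℝ) : ℂ) *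
      ∑ m : ZMod (n+1), ZMod.stdAddChar (m * j) * F i (i + m) := by
  have hf : ∀ k : ZMod (n+1), fourierVec (n+1) j k =
      ((1 / Real.sqrt (n+1 : ℕ) : ℝ) : ℂ) * ZMod.stdAddChar (k * j) := by
    intro k
    rw [← omega_pow_eq]; rfl
  have hs : ((1 / Real.sqrt (n+1 : ℕ) : ℝ) : ℂ) * ((1 / Real.sqrt (n+1 : ℕ) : ℝ) : ℂ)
      = ((1 / ((n:ℝ)+1) : ℝ) : ℂ) := by
    rw [← Complex.ofReal_mul]
    congr 1
    rw [div_mul_div_comm, Real.mul_self_sqrt (by positivity)]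
    push_cast; ring
  have hc : (starRingEnd ℂ) (ZMod.stdAddChar (i * j)) = ZMod.stdAddChar (-(i * j)) := by
    rw [AddChar.map_neg_eq_conj]
  unfold KDQ
  change _ * ∑ k : ZMod (n+1), F i k * fourierVec (n+1) j k = _
  rw [← Equiv.sum_comp (Equiv.addLeft i), hf, map_mul, Complex.conj_ofReal, hc, ← hs,
    Finset.mul_sum, Finset.mul_sum]
  refine Finset.sum_congr rfl fun m _ => ?_
  rw [Equiv.coe_addLeft, hf]
  have : ZMod.stdAddChar (m * j) =
      ZMod.stdAddChar (-(i * j)) * ZMod.stdAddChar ((i + m) * j) := by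
    rw [← AddChar.map_add_eq_mul]; congr 1; ring
  rw [this]; ring

lemma KDQ_real_iff (n : ℕ) (F : Matrix (ZMod (n+1)) (ZMod (n+1)) ℂ) (i : ZMod (n+1)) :
    (∀ j : ZMod (n+1), (KDQ (n+1) F i j).im = 0) ↔
      ∀ m, F i (i - m) = (starRingEnd ℂ) (F i (i + m)) := by
  have hn : (1 / ((n:ℝ)+1)) ≠ 0 := by positivity
  have h1 : ∀ j : ZMod (n+1), (KDQ (n+1) F i j).im = 0 ↔
      ∑ m : ZMod (n+1), ZMod.stdAddChar (m * j) *
        (F i (i + m) - (starRingEnd ℂ) (F i (i - m))) = 0 := by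
    intro j
    rw [KDQ_eq, Complex.im_ofReal_mul, mul_eq_zero, or_iff_right hn, ← Complex.conj_eq_iff_im,
      eq_comm, ← sub_eq_zero, map_sum,
      ← Equiv.sum_comp (Equiv.neg (ZMod (n+1))) (fun x => (starRingEnd ℂ) _),
      ← Finset.sum_sub_distrib]
    refine Eq.congr (Finset.sum_congr rfl fun m _ => ?_) rfl
    have hc : (starRingEnd ℂ) (ZMod.stdAddChar (-m * j)) = ZMod.stdAddChar (m * j) := by
      rw [← AddChar.map_neg_eq_conj, neg_mul, neg_neg]
    have hm : (starRingEnd ℂ) (ZMod.stdAddChar (-m * j) * F i (i + -m)) =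
        ZMod.stdAddChar (m * j) * (starRingEnd ℂ) (F i (i - m)) := by
      rw [RingHom.map_mul, hc, ← sub_eq_add_neg]
    rw [mul_sub]
    exact congrArg _ hm
  simp only [h1]
  constructor
  · intro h
    have : (fun m : ZMod (n+1) => F i (i + m) - (starRingEnd ℂ) (F i (i - m))) = 0 := by
      apply ZMod.dft.injective
      rw [map_zero]
      funext j
      rw [ZMod.dft_apply]
      simpa using h (-j)
    intro m
    have := congrFun this m
    simp only [Pi.zero_apply, sub_eq_zero] at this
    rw [this, Complex.conj_conj]
  · intro h j
    refine Finset.sum_eq_zero fun m _ => ?_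
    rw [h m, Complex.conj_conj, sub_self, mul_zero]

def KDrZ (n : ℕ) : Set (Matrix (ZMod (n+1)) (ZMod (n+1)) ℂ) := KDr (n+1)

lemma mem_KDr_iff (n : ℕ) (F : Matrix (ZMod (n+1)) (ZMod (n+1)) ℂ) :
    F ∈ KDrZ n ↔ (∀ i m, F i (i - m) = (starRingEnd ℂ) (F i (i + m))) ∧
      ∀ i m, F (i + m) (i + m + m) = F i (i + m) := by
  have h0 : F ∈ KDrZ n ↔ F.IsHermitian ∧
      ∀ i m, F i (i - m) = (starRingEnd ℂ) (F i (i + m)) := by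
    refine and_congr Iff.rfl ?_
    exact forall_congr' fun i => KDQ_real_iff n F i
  rw [h0, and_comm]
  refine and_congr_right fun h => ?_
  constructor
  · intro hF i m
    have h2 := hF.apply (i + m) i
    have h3 := h (i + m) m
    rw [add_sub_cancel_right] at h3
    rw [← Complex.conj_conj (F (i+m) (i+m+m)), ← h3]
    have h4 := hF.apply i (i + m)
    exact h4
  · intro hF
    refine Matrix.IsHermitian.ext fun i k => ?_
    obtain ⟨m, rfl⟩ : ∃ m, k = i + m := ⟨k - i, by ring⟩
    have h3 := h (i + m) m
    rw [add_sub_cancel_right] at h3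
    change (starRingEnd ℂ) (F (i + m) i) = _
    rw [h3, Complex.conj_conj, hF]

abbrev KDX (n : ℕ) : Type := Σ m : ZMod (n+1), ZMod (n+1) ⧸ AddSubgroup.zmultiples m

def KDT (n : ℕ) : (KDX n → ℝ) →ₗ[ℝ] Matrix (ZMod (n+1)) (ZMod (n+1)) ℂ where
  toFun h := Matrix.of fun i k =>
    ⟨(h ⟨k - i, i⟩ + h ⟨i - k, i⟩) / 2, (h ⟨k - i, i⟩ - h ⟨i - k, i⟩) / 2⟩
  map_add' h g := by
    ext i k
    apply Complex.ext <;> simp <;> ring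
  map_smul' c h := by
    ext i k
    apply Complex.ext <;> simp <;> ring

lemma KDT_inj (n : ℕ) : Function.Injective (KDT n) := by
  intro h g e
  funext ⟨m, c⟩
  induction c using QuotientAddGroup.induction_on with
  | H i =>
    have e1 := congrFun (congrFun e i) (i + m)
    have hr := congrArg Complex.re e1
    have hi := congrArg Complex.im e1
    simp only [KDT, LinearMap.coe_mk, AddHom.coe_mk, Matrix.of_apply] at hr hi
    have e1 : i + m - i = m := by ring
    rw [e1] at hr hi
    linarith

lemma shift_inv {n : ℕ} {F : Matrix (ZMod (n+1)) (ZMod (n+1)) ℂ} {m : ZMod (n+1)}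
    (h : ∀ i, F (i + m) (i + m + m) = F i (i + m)) (z : ℤ) :
    ∀ i, F (i + z • m) (i + z • m + m) = F i (i + m) := by
  induction z using Int.induction_on with
  | zero => intro i; simp
  | succ k ih =>
    intro i
    rw [add_zsmul, one_zsmul, ← add_assoc, h, ih]
  | pred k ih =>
    intro i
    rw [← ih i, ← h (i + (-(k:ℤ) - 1) • m)]
    have : i + (-(k:ℤ) - 1) • m + m = i + (-(k:ℤ)) • m := by
      rw [sub_zsmul, one_zsmul]; ring
    rw [this]

lemma KDT_range (n : ℕ) : (Submodule.span ℝ (KDrZ n) :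
    Submodule ℝ (Matrix (ZMod (n+1)) (ZMod (n+1)) ℂ)) = LinearMap.range (KDT n) := by
  apply le_antisymm
  · rw [Submodule.span_le]
    intro F hF
    obtain ⟨h1, h2⟩ := (mem_KDr_iff n F).1 hF
    refine ⟨fun x => (F x.2.out (x.2.out + x.1)).re + (F x.2.out (x.2.out + x.1)).im, ?_⟩
    have key : ∀ (i m : ZMod (n+1)), F ((i : ZMod (n+1) ⧸ AddSubgroup.zmultiples m).out)
        ((i : ZMod (n+1) ⧸ AddSubgroup.zmultiples m).out + m) = F i (i + m) := by
      intro i m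
      obtain ⟨⟨y, z, hz⟩, hy⟩ := QuotientAddGroup.mk_out_eq_add (AddSubgroup.zmultiples m) i
      simp only at hz hy
      rw [hy, ← hz, shift_inv (fun i => h2 i m)]
    ext i k
    obtain ⟨m, rfl⟩ : ∃ m, k = i + m := ⟨k - i, by ring⟩
    have h3 := h1 i m
    have e1 : i + m - i = m := by ring
    have e2 : i - (i + m) = -m := by ring
    simp only [KDT, LinearMap.coe_mk, AddHom.coe_mk, Matrix.of_apply, e1, e2, key]
    rw [← sub_eq_add_neg, h3]
    apply Complex.ext <;> simp
    ring
  · rintro _ ⟨h, rfl⟩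
    apply Submodule.subset_span
    rw [mem_KDr_iff]
    constructor
    · intro i m
      have e1 : i + m - i = m := by ring
      have e2 : i - (i + m) = -m := by ring
      have e3 : i - m - i = -m := by ring
      have e4 : i - (i - m) = m := by ring
      simp only [KDT, LinearMap.coe_mk, AddHom.coe_mk, Matrix.of_apply]
      rw [e1, e2, e3, e4]
      apply Complex.ext <;> simp <;> ring
    · intro i m
      have e1 : i + m - i = m := by ring
      have e2 : i - (i + m) = -m := by ring
      have e3 : i + m + m - (i + m) = m := by ring
      have e4 : i + m - (i + m + m) = -m := by ring
      have q1 : ((i + m : ZMod (n+1)) : ZMod (n+1) ⧸ AddSubgroup.zmultiples m) = i := by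
        rw [QuotientAddGroup.eq]
        exact ⟨-1, by simp⟩
      have q2 : ((i + m : ZMod (n+1)) : ZMod (n+1) ⧸ AddSubgroup.zmultiples (-m)) = i := by
        rw [QuotientAddGroup.eq]
        exact ⟨1, by simp⟩
      simp only [KDT, LinearMap.coe_mk, AddHom.coe_mk, Matrix.of_apply]
      rw [e1, e2, e3, e4, q1, q2]

lemma finrank_KDr (n : ℕ) : Module.finrank ℝ (Submodule.span ℝ (KDr (n+1))) =
    ∑ m : ZMod (n+1), (n+1) / addOrderOf m := by
  have : Module.finrank ℝ (Submodule.span ℝ (KDrZ n) :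
    Submodule ℝ (Matrix (ZMod (n+1)) (ZMod (n+1)) ℂ)) = ∑ m : ZMod (n+1), (n+1) / addOrderOf m := by
    classical
    rw [KDT_range, LinearMap.finrank_range_of_inj (KDT_inj n)]
    haveI : Fintype (KDX n) := Fintype.ofFinite _
    rw [Module.finrank_fintype_fun_eq_card, ← Nat.card_eq_fintype_card, Nat.card_sigma]
    refine Finset.sum_congr rfl fun m _ => ?_
    have := AddSubgroup.card_eq_card_quotient_mul_card_addSubgroup (AddSubgroup.zmultiples m)
    rw [Nat.card_zmultiples, Nat.card_zmod] at this
    exact (Nat.div_eq_of_eq_mul_left (addOrderOf_pos m) this).symm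
  exact this

lemma sum_prime (p : ℕ) [NeZero p] (hp : p.Prime) :
    ∑ a : ZMod p, p / addOrderOf a = 2 * p - 1 := by
  haveI := Fact.mk hp
  classical
  rw [← Finset.add_sum_erase _ _ (Finset.mem_univ (0 : ZMod p))]
  have : ∀ a ∈ Finset.univ.erase (0 : ZMod p), p / addOrderOf a = 1 := by
    intro a ha
    rw [addOrderOf_eq_prime (p := p) (by simp) (Finset.ne_of_mem_erase ha),
      Nat.div_self hp.pos]
  rw [Finset.sum_congr rfl this]
  simp [Finset.card_erase_of_mem]
  have := hp.pos
  omega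

lemma sum_mul (p q : ℕ) [NeZero p] [NeZero q] [NeZero (p * q)] (h : Nat.Coprime p q) :
    ∑ a : ZMod (p * q), (p * q) / addOrderOf a =
      (∑ a : ZMod p, p / addOrderOf a) * ∑ a : ZMod q, q / addOrderOf a := by
  rw [Finset.sum_mul_sum, ← Finset.sum_product', Finset.univ_product_univ,
    ← Equiv.sum_comp (ZMod.chineseRemainder h).toEquiv]
  refine Finset.sum_congr rfl fun a _ => ?_
  have e := addOrderOf_injective (ZMod.chineseRemainder h).toAddEquiv.toAddMonoidHom
    (ZMod.chineseRemainder h).injective a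
  rw [← e]
  generalize hx : (ZMod.chineseRemainder h).toEquiv a = x
  have hx' : (ZMod.chineseRemainder h).toAddEquiv.toAddMonoidHom a = x := hx
  rw [hx', Prod.addOrderOf]
  have h1 : addOrderOf x.1 ∣ p := by simpa using addOrderOf_dvd_natCard x.1
  have h2 : addOrderOf x.2 ∣ q := by simpa using addOrderOf_dvd_natCard x.2
  rw [(Nat.Coprime.of_dvd h1 h2 h).lcm_eq_mul, Nat.mul_div_mul_comm h1 h2]

/-- For `d = pq` with `p, q` distinct primes, the real vector space
`KD^r` has dimension `(2p−1)(2q−1)`. -/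
theorem stmt8 (p q d : ℕ) (hp : p.Prime) (hq : q.Prime) (hpq : p ≠ q)
    (hd : d = p * q) :
    Module.finrank ℝ (Submodule.span ℝ (KDr d)) = (2 * p - 1) * (2 * q - 1) := by
  subst hd
  haveI : NeZero p := ⟨hp.ne_zero⟩
  haveI : NeZero q := ⟨hq.ne_zero⟩
  haveI : NeZero (p * q) := ⟨mul_ne_zero hp.ne_zero hq.ne_zero⟩
  rw [← sum_prime p hp, ← sum_prime q hq, ← sum_mul p q ((Nat.coprime_primes hp hq).2 hpq)]
  have gen : ∀ (d : ℕ) [NeZero d], Module.finrank ℝ (Submodule.span ℝ (KDr d)) =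
      ∑ m : ZMod d, d / addOrderOf m := by
    intro d hd
    obtain ⟨n, rfl⟩ := Nat.exists_eq_succ_of_ne_zero hd.out
    rw [finrank_KDr]
  exact gen (p * q)
end
end
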